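/- Every uniform algebra satisfies the complex Mazur-Ulam property: if A is a closed subalgebra of C(X, ℂ) (X compact Hausdorff) containing the constants and separating points of X, endowed with the supremum norm, then for any complex Banach space B₂ and any surjective isometry T : S(A) → S(B₂) between unit spheres, T extends to a surjective real-linear isometry from A onto B₂. -/

import Mathlib

namespace MUP

section Sphere

structure SI {E F : Type*} [NormedAddCommGroup E] [NormedAddCommGroup F]
    (T : E → F) (T' : F → E) : Prop where
  n1 : ∀ x, ‖x‖ = 1 → ‖T x‖ = 1
  n2 : ∀ y, ‖y‖ = 1 → ‖T' y‖ = 1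
  i1 : ∀ x, ‖x‖ = 1 → T' (T x) = x
  i2 : ∀ y, ‖y‖ = 1 → T (T' y) = y
  d1 : ∀ x x', ‖x‖ = 1 → ‖x'‖ = 1 → ‖T x - T x'‖ = ‖x - x'‖
  d2 : ∀ y y', ‖y‖ = 1 → ‖y'‖ = 1 → ‖T' y - T' y'‖ = ‖y - y'‖

/-- Maximal convex subsets of the unit sphere. -/
structure MC {E : Type*} [NormedAddCommGroup E] [NormedSpace ℝ E] (C : Set E) : Prop where
  n : ∀ c ∈ C, ‖c‖ = 1
  conv : Convex ℝ C
  max : ∀ y, ‖y‖ = 1 → (∀ c ∈ C, ‖y + c‖ = 2) → y ∈ C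

variable {E F : Type*} [NormedAddCommGroup E] [NormedAddCommGroup F]
  [NormedSpace ℝ E] [NormedSpace ℝ F] {T : E → F} {T' : F → E}

theorem SI.symm {E F : Type*} [NormedAddCommGroup E] [NormedAddCommGroup F]
    {T : E → F} {T' : F → E} (h : SI T T') : SI T' T :=
  ⟨h.n2, h.n1, h.i2, h.i1, h.d2, h.d1⟩

theorem seg {x y : E} (hx : ‖x‖ = 1) (hy : ‖y‖ = 1) (h : ‖x + y‖ = 2) {a b : ℝ}
    (ha : 0 ≤ a) (hb : 0 ≤ b) (hab : a + b = 1) : ‖a • x + b • y‖ = 1 := by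
  have key : ∀ a b : ℝ, 0 ≤ a → 0 ≤ b → a + b = 1 → ‖a • x + b • y‖ ≤ 1 := by
    intro a b ha hb hab
    calc ‖a • x + b • y‖ ≤ ‖a • x‖ + ‖b • y‖ := norm_add_le _ _
      _ = 1 := by rw [norm_smul, norm_smul, hx, hy, Real.norm_of_nonneg ha, Real.norm_of_nonneg hb]; linarith
  have h1 := key a b ha hb hab
  have h2 := key b a hb ha (by linarith)
  have e : x + y = (a • x + b • y) + (b • x + a • y) := by
    have : b = 1 - a := by linarith
    subst this; module
  have h3 := norm_add_le (a • x + b • y) (b • x + a • y)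
  rw [← e, h] at h3
  linarith

theorem norm_add_le_two {E : Type*} [NormedAddCommGroup E] {x y : E} (hx : ‖x‖ = 1) (hy : ‖y‖ = 1) : ‖x + y‖ ≤ 2 := by
  have := norm_add_le x y; linarith

theorem SI.claim1 (h : SI T T') {x y : E} (hx : ‖x‖ = 1) (hy : ‖y‖ = 1) (hxy : ‖x + y‖ = 2) :
    ‖T x + T y‖ = 2 := by
  apply le_antisymm (norm_add_le_two (h.n1 x hx) (h.n1 y hy))
  apply le_of_forall_pos_le_add
  intro ε hε
  set t : ℝ := min (ε / 2) 1 with ht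
  have t0 : 0 < t := by positivity
  have t1 : t ≤ 1 := min_le_right _ _
  have t2 : t ≤ ε / 2 := min_le_left _ _
  set z := (1 - t) • x + t • y with hz
  have nz : ‖z‖ = 1 := seg hx hy hxy (by linarith) t0.le (by ring)
  have nTz : ‖-(T z)‖ = 1 := by rw [norm_neg]; exact h.n1 z nz
  set w := T' (-(T z)) with hw
  have nw : ‖w‖ = 1 := h.n2 _ nTz
  have Tw : T w = -(T z) := h.i2 _ nTz
  have hzw : ‖z - w‖ = 2 := by
    rw [← h.d1 z w nz nw, Tw, sub_neg_eq_add, ← two_smul ℝ, norm_smul, h.n1 z nz]; norm_num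
  have hyw : 2 ≤ ‖y - w‖ := by
    have e : z - w = (1 - t) • (x - w) + t • (y - w) := by rw [hz]; module
    have h1 : ‖x - w‖ ≤ 2 := by have := norm_sub_le x w; linarith
    have h2 : ‖z - w‖ ≤ (1 - t) * ‖x - w‖ + t * ‖y - w‖ := by
      rw [e]
      refine (norm_add_le _ _).trans ?_
      rw [norm_smul, norm_smul, Real.norm_of_nonneg (by linarith), Real.norm_of_nonneg t0.le]
    nlinarith
  have h4 : 2 ≤ ‖T y + T z‖ := by
    have := h.d1 y w hy nw
    rw [Tw, sub_neg_eq_add] at this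
    linarith
  have h5 : ‖T z - T x‖ ≤ ε := by
    rw [h.d1 z x nz hx]
    have e : z - x = t • (y - x) := by rw [hz]; module
    rw [e, norm_smul, Real.norm_of_nonneg t0.le]
    have := norm_sub_le y x
    nlinarith
  have h6 : T y + T z = (T x + T y) + (T z - T x) := by abel
  have h7 := norm_add_le (T x + T y) (T z - T x)
  rw [← h6] at h7
  linarith

theorem MC.pair {C : Set E} (hC : MC C) {x y : E} (hx : x ∈ C) (hy : y ∈ C) : ‖x + y‖ = 2 := by
  have h1 := hC.n _ (hC.conv hx hy (a := 1/2) (b := 1/2) (by norm_num) (by norm_num) (by norm_num))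
  have e : x + y = (2:ℝ) • ((1/2:ℝ) • x + (1/2:ℝ) • y) := by module
  rw [e, norm_smul, h1]; norm_num

theorem exists_MC {x : E} (hx : ‖x‖ = 1) : ∃ C : Set E, MC C ∧ x ∈ C := by
  obtain ⟨C, hxC, hC⟩ := zorn_subset_nonempty
    {C : Set E | Convex ℝ C ∧ ∀ c ∈ C, ‖c‖ = 1} (by
      intro c hc hchain hne
      refine ⟨⋃₀ c, ⟨?_, ?_⟩, fun s hs => Set.subset_sUnion_of_mem hs⟩
      · exact hchain.directedOn.convex_sUnion (fun s hs => (hc hs).1)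
      · rintro y ⟨s, hs, hy⟩
        exact (hc hs).2 y hy) {x} ⟨convex_singleton x, by simpa using hx⟩
  refine ⟨C, ⟨hC.prop.2, hC.prop.1, ?_⟩, hxC rfl⟩
  intro y hy hyC
  have hsub : C ⊆ convexHull ℝ (insert y C) :=
    (Set.subset_insert y C).trans (subset_convexHull ℝ _)
  have hmem : convexHull ℝ (insert y C) ∈ {C : Set E | Convex ℝ C ∧ ∀ c ∈ C, ‖c‖ = 1} := by
    refine ⟨convex_convexHull ℝ _, ?_⟩
    intro z hz
    rw [convexHull_insert ⟨x, hxC rfl⟩, hC.prop.1.convexHull_eq, convexJoin_singleton_left] at hz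
    simp only [Set.mem_iUnion] at hz
    obtain ⟨c, hc, a, b, ha, hb, hab, rfl⟩ := hz
    exact seg hy (hC.prop.2 c hc) (hyC c hc) ha hb hab
  exact hC.le_of_ge hmem hsub (subset_convexHull ℝ _ (Set.mem_insert y C))

theorem SI.neg (h : SI T T') {C : Set E} (hC : MC C) {c : E} (hc : c ∈ C) :
    -T' (-(T c)) ∈ C := by
  have nTc : ‖-(T c)‖ = 1 := by rw [norm_neg]; exact h.n1 c (hC.n c hc)
  refine hC.max _ (by rw [norm_neg]; exact h.n2 _ nTc) fun c' hc' => ?_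
  have e : -T' (-(T c)) + c' = c' - T' (-(T c)) := by abel
  rw [e, ← h.d1 _ _ (hC.n _ hc') (h.n2 _ nTc), h.i2 _ nTc, sub_neg_eq_add]
  exact h.claim1 (hC.n _ hc') (hC.n _ hc) (hC.pair hc' hc)

theorem SI.image (h : SI T T') {C : Set E} (hC : MC C) : MC (T '' C) := by
  have hmax : ∀ y, ‖y‖ = 1 → (∀ c ∈ T '' C, ‖y + c‖ = 2) → y ∈ T '' C := by
    intro y hy hyC
    refine ⟨T' y, hC.max _ (h.n2 y hy) fun c hc => ?_, h.i2 y hy⟩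
    have := h.symm.claim1 hy (h.n1 c (hC.n c hc)) (hyC _ ⟨c, hc, rfl⟩)
    rwa [h.i1 c (hC.n c hc)] at this
  refine ⟨?_, ?_, hmax⟩
  · rintro _ ⟨c, hc, rfl⟩; exact h.n1 c (hC.n c hc)
  rintro _ ⟨z1, hz1, rfl⟩ _ ⟨z2, hz2, rfl⟩ a b ha hb hab
  have n1 := hC.n _ hz1
  have n2 := hC.n _ hz2
  refine hmax _ (seg (h.n1 _ n1) (h.n1 _ n2) (h.claim1 n1 n2 (hC.pair hz1 hz2)) ha hb hab) ?_
  rintro _ ⟨z3, hz3, rfl⟩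
  have n3 := hC.n _ hz3
  set c : E := (2/3:ℝ) • ((1/2:ℝ) • z1 + (1/2:ℝ) • z2) + (1/3:ℝ) • z3 with hc
  have hcC : c ∈ C := hC.conv (hC.conv hz1 hz2 (by norm_num) (by norm_num) (by norm_num)) hz3
    (by norm_num) (by norm_num) (by norm_num)
  have nc : ‖-c‖ = 1 := by rw [norm_neg]; exact hC.n _ hcC
  obtain ⟨M, hM, hdM⟩ := exists_MC (x := -T (-c)) (by rw [norm_neg]; exact h.n1 _ nc)
  have key : ∀ m ∈ M, ‖m + T z1‖ = 2 ∧ ‖m + T z2‖ = 2 ∧ ‖m + T z3‖ = 2 := by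
    intro m hm
    have nm := hM.n m hm
    have nm' := h.n2 m nm
    have h1 : ‖T' m + c‖ = 2 := by
      have := hM.pair hm hdM
      rw [← sub_eq_add_neg, ← h.i2 m nm, h.d1 _ _ nm' nc, sub_neg_eq_add] at this
      exact this
    have b1 := norm_add_le_two nm' n1
    have b2 := norm_add_le_two nm' n2
    have b3 := norm_add_le_two nm' n3
    have e : T' m + c = (1/3:ℝ) • ((T' m + z1) + (T' m + z2) + (T' m + z3)) := by
      rw [hc]; module
    rw [e, norm_smul, Real.norm_of_nonneg (by norm_num)] at h1
    have h2 := norm_add₃_le (a := T' m + z1) (b := T' m + z2) (c := T' m + z3)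
    have g := fun z (nz : ‖z‖ = 1) (hz : ‖T' m + z‖ = 2) => h.claim1 nm' nz hz
    rw [h.i2 m nm] at g
    exact ⟨g _ n1 (by linarith), g _ n2 (by linarith), g _ n3 (by linarith)⟩
  have m1 : T z1 ∈ M := hM.max _ (h.n1 _ n1) fun m hm => by rw [add_comm]; exact (key m hm).1
  have m2 : T z2 ∈ M := hM.max _ (h.n1 _ n2) fun m hm => by rw [add_comm]; exact (key m hm).2.1
  have m3 : T z3 ∈ M := hM.max _ (h.n1 _ n3) fun m hm => by rw [add_comm]; exact (key m hm).2.2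
  exact hM.pair (hM.conv m1 m2 ha hb hab) m3

theorem exists_functional {B : Type*} [NormedAddCommGroup B] [NormedSpace ℂ B] {D : Set B}
    (hD : MC D) :
    ∃ q : B →L[ℂ] ℂ, (∀ b, ‖q b‖ ≤ ‖b‖) ∧ ∀ d ∈ D, q d = 1 := by
  obtain ⟨f, u, h1, h2⟩ := RCLike.geometric_hahn_banach_open (𝕜 := ℂ) (convex_ball (0:B) 1) Metric.isOpen_ball
    hD.conv (by
      rw [Set.disjoint_left]
      intro b hb hb'
      have := hD.n b hb'
      simp at hb; linarith)
  have u0 : 0 < u := by simpa using h1 0 (by simp)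
  have hb : ∀ b, ‖b‖ < 1 → ‖f b‖ ≤ u := by
    intro b hb
    by_cases hf : f b = 0
    · rw [hf]; simpa using u0.le
    have := h1 ((starRingEnd ℂ (f b) / ‖f b‖) • b) (by
      simp [norm_smul, norm_ne_zero_iff.2 hf, hb])
    rw [map_smul, smul_eq_mul, div_mul_eq_mul_div, mul_comm, Complex.mul_conj, Complex.normSq_eq_norm_sq] at this
    have e : (((‖f b‖^2 : ℝ):ℂ) / (‖f b‖:ℂ)) = ((‖f b‖ : ℝ) : ℂ) := by
      have : (‖f b‖ : ℂ) ≠ 0 := by exact_mod_cast norm_ne_zero_iff.2 hf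
      push_cast; field_simp
    rw [e] at this
    simp at this
    exact this.le
  have hb2 : ∀ b, ‖f b‖ ≤ u * ‖b‖ := by
    intro b
    have : ∀ᶠ t : ℝ in nhdsWithin ‖b‖ (Set.Ioi ‖b‖), ‖f b‖ ≤ u * t := by
      filter_upwards [self_mem_nhdsWithin] with t ht
      have t0 : 0 < t := (norm_nonneg b).trans_lt ht
      have := hb (((t:ℂ))⁻¹ • b) (by
        rw [norm_smul, norm_inv, Complex.norm_real, Real.norm_of_nonneg t0.le, inv_mul_lt_iff₀ t0]
        simpa using ht)
      rw [map_smul, norm_smul, norm_inv, Complex.norm_real, Real.norm_of_nonneg t0.le,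
        inv_mul_le_iff₀ t0] at this
      linarith
    refine ge_of_tendsto ?_ this
    exact ((continuous_const.mul continuous_id).tendsto _).mono_left nhdsWithin_le_nhds
  have uc : (u:ℂ) ≠ 0 := by exact_mod_cast u0.ne'
  refine ⟨((u:ℂ)⁻¹) • f, ?_, ?_⟩
  · intro b
    simp only [smul_apply, norm_smul, norm_inv, Complex.norm_real,
      Real.norm_of_nonneg u0.le]
    rw [inv_mul_le_iff₀ u0]; exact hb2 b
  · intro d hd
    have a1 := hb2 d
    rw [hD.n d hd, mul_one] at a1
    have a2 := h2 d hd
    simp only [RCLike.re_to_complex] at a2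
    have a3 := Complex.re_le_norm (f d)
    have a4 : (f d).re = u := by linarith
    have a5 : (f d).im = 0 := by
      have := Complex.sq_norm_sub_sq_re (f d)
      have : ‖f d‖ = u := by linarith
      rw [this, a4] at *
      nlinarith
    have : f d = u := Complex.ext (by simpa using a4) (by simpa using a5)
    simp [this, uc]

theorem MC.smul {B : Type*} [NormedAddCommGroup B] [NormedSpace ℂ B] {D : Set B}
    (hD : MC D) {α : ℂ} (hα : ‖α‖ = 1) : MC {b | α • b ∈ D} := by
  have α0 : α ≠ 0 := by intro h; simp [h] at hα
  refine ⟨?_, ?_, ?_⟩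
  · intro c hc
    have := hD.n _ hc
    rwa [norm_smul, hα, one_mul] at this
  · intro x hx y hy a b ha hb hab
    have := hD.conv hx hy ha hb hab
    simp only [Set.mem_ofPred_eq, smul_add]
    rwa [smul_comm α a, smul_comm α b]
  · intro y hy h
    refine hD.max _ (by rw [norm_smul, hα, hy, one_mul]) fun c hc => ?_
    have := h (α⁻¹ • c) (by simpa [smul_smul, α0] using hc)
    have e : α • y + c = α • (y + α⁻¹ • c) := by simp [smul_smul, α0]
    rw [e, norm_smul, hα, this, one_mul]

end Sphere

section UA

set_option linter.unusedSectionVars false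

variable {X : Type*} [TopologicalSpace X] [CompactSpace X]
  {A : Type*} [NormedRing A] [NormedAlgebra ℂ A] [CompleteSpace A]
  (ev : A →ₐ[ℂ] C(X, ℂ)) 

theorem eq_one_of_re {z : ℂ} (hz : ‖z‖ ≤ 1) (h : z.re = 1) : z = 1 := by
  have h1 : ‖z‖ ^ 2 ≤ 1 := by nlinarith [norm_nonneg z]
  rw [Complex.sq_norm, Complex.normSq_apply, h] at h1
  exact Complex.ext (by simpa using h) (by simp; nlinarith)

theorem norm_half_lt {z : ℂ} (hz : ‖z‖ ≤ 1) (h : z ≠ 1) : ‖(1/2:ℂ) * (1 + z)‖ < 1 := by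
  have h0 : z.re < 1 := lt_of_le_of_ne ((Complex.re_le_norm z).trans hz)
    fun h' => h (eq_one_of_re hz h')
  have h1 : ‖z‖ ^ 2 ≤ 1 := by nlinarith [norm_nonneg z]
  rw [Complex.sq_norm, Complex.normSq_apply] at h1
  have : ‖1 + z‖ ^ 2 < 4 := by
    rw [Complex.sq_norm, Complex.normSq_apply]; simp; nlinarith
  have : ‖1 + z‖ < 2 := by nlinarith [norm_nonneg (1 + z)]
  rw [norm_mul]; norm_num; linarith

theorem half_add_eq {z w : ℂ} (hz : ‖z‖ ≤ 1) (hw : ‖w‖ ≤ 1) (h : (1/2:ℂ) * (z + w) = 1) :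
    z = 1 ∧ w = 1 := by
  have h1 : z + w = 2 := by linear_combination 2 * h
  have h2 := congrArg Complex.re h1
  simp at h2
  have a := (Complex.re_le_norm z).trans hz
  have b := (Complex.re_le_norm w).trans hw
  exact ⟨eq_one_of_re hz (by linarith), eq_one_of_re hw (by linarith)⟩

def K (x : X) : Set X := {y | ∀ f : A, ‖f‖ ≤ 1 → ev f x = 1 → ev f y = 1}

theorem self_mem_K {ev : A →ₐ[ℂ] C(X, ℂ)} (x : X) : x ∈ K ev x := fun _ _ h => h

theorem isClosed_K (x : X) : IsClosed (K ev x) := by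
  have : K ev x = ⋂ f : A, ⋂ _ : ‖f‖ ≤ 1, ⋂ _ : ev f x = 1, {y | ev f y = 1} := by
    ext y; simp [K]
  rw [this]
  refine isClosed_iInter fun f => isClosed_iInter fun _ => isClosed_iInter fun _ => ?_
  exact isClosed_eq (ev f).continuous continuous_const


theorem ev_le (hev : ∀ f, ‖ev f‖ = ‖f‖) (f : A) (y : X) : ‖ev f y‖ ≤ ‖f‖ := by
  rw [← hev]; exact (ev f).norm_coe_le_norm y

theorem ev_le_one (hev : ∀ f, ‖ev f‖ = ‖f‖) {f : A} (hf : ‖f‖ ≤ 1) (y : X) : ‖ev f y‖ ≤ 1 := (ev_le ev hev f y).trans hf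

theorem norm_le_of (hev : ∀ f, ‖ev f‖ = ‖f‖) {f : A} {c : ℝ} (hc : 0 ≤ c) (h : ∀ y, ‖ev f y‖ ≤ c) : ‖f‖ ≤ c := by
  rw [← hev]; exact (ContinuousMap.norm_le _ hc).2 h

theorem norm_one_of (hev : ∀ f, ‖ev f‖ = ‖f‖) {f : A} (h : ∀ y, ‖ev f y‖ ≤ 1) {x : X} (hx : ‖ev f x‖ = 1) : ‖f‖ = 1 :=
  le_antisymm (norm_le_of ev hev zero_le_one h) (hx ▸ ev_le ev hev f x)

theorem norm_one_A (hev : ∀ f, ‖ev f‖ = ‖f‖) (x : X) : ‖(1:A)‖ = 1 := 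
  norm_one_of ev hev (by simp) (x := x) (by simp)

theorem exists_attain (hev : ∀ f, ‖ev f‖ = ‖f‖) {f : A} (hf : ‖f‖ = 1) : ∃ x, ‖ev f x‖ = 1 := by
  by_contra! hcon
  have : ‖ev f‖ < 1 := (ContinuousMap.norm_lt_iff _ one_pos).2 fun x =>
    lt_of_le_of_ne (ev_le_one ev hev hf.le x) (hcon x)
  rw [hev] at this; linarith

theorem peak (hev : ∀ f, ‖ev f‖ = ‖f‖) (x : X) {U : Set X} (hU : IsOpen U) (hKU : K ev x ⊆ U) {ε : ℝ} (hε : 0 < ε) :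
    ∃ h : A, ‖h‖ ≤ 1 ∧ ev h x = 1 ∧ ∀ y, y ∉ U → ‖ev h y‖ ≤ ε := by
  let ι := {f : A // ‖f‖ ≤ 1 ∧ ev f x = 1}
  have n1 := norm_one_A ev hev x
  have : Nonempty ι := ⟨⟨1, n1.le, by simp⟩⟩
  have half : ∀ f g : A, ‖f‖ ≤ 1 → ‖g‖ ≤ 1 → ‖(1/2:ℂ) • (f + g)‖ ≤ 1 := by
    intro f g hf hg
    rw [norm_smul]
    have := norm_add_le f g
    norm_num; linarith
  obtain ⟨⟨f, hf, hfx⟩, hfU⟩ := hU.isClosed_compl.isCompact.elim_directed_family_closed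
    (fun f : ι => {y | ev f.1 y = 1})
    (fun f => isClosed_eq (ev f.1).continuous continuous_const)
    (by
      ext y
      simp only [Set.mem_inter_iff, Set.mem_compl_iff, Set.mem_iInter, Set.mem_empty_iff_false,
        iff_false, not_and]
      intro hy h
      exact hy (hKU fun f hf hfx => h ⟨f, hf, hfx⟩))
    (by
      rintro ⟨f, hf, hfx⟩ ⟨g, hg, hgx⟩
      refine ⟨⟨(1/2:ℂ) • (f + g), half f g hf hg, ?_⟩, ?_, ?_⟩
      · simp [hfx, hgx]; norm_num
      · intro y hy
        have hy' : (1/2:ℂ) * (ev f y + ev g y) = 1 := by simpa [mul_add] using hy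
        exact (half_add_eq (ev_le_one ev hev hf y) (ev_le_one ev hev hg y) hy').1
      · intro y hy
        have hy' : (1/2:ℂ) * (ev f y + ev g y) = 1 := by simpa [mul_add] using hy
        exact (half_add_eq (ev_le_one ev hev hf y) (ev_le_one ev hev hg y) hy').2)
  set h : A := (1/2:ℂ) • (1 + f) with hh
  have hle : ‖h‖ ≤ 1 := half 1 f n1.le hf
  have hx : ev h x = 1 := by simp [hh, hfx]; norm_num
  have hlt : ∀ y, y ∉ U → ‖ev h y‖ < 1 := by
    intro y hy
    have : ev h y = (1/2:ℂ) * (1 + ev f y) := by simp [hh, mul_add]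
    rw [this]
    refine norm_half_lt (ev_le_one ev hev hf y) fun h1 => ?_
    have : y ∈ Uᶜ ∩ {y | ev f y = 1} := ⟨hy, h1⟩
    rw [hfU] at this; exact this
  obtain ⟨ρ, ρ0, ρ1, hρ⟩ : ∃ ρ : ℝ, 0 ≤ ρ ∧ ρ < 1 ∧ ∀ y, y ∉ U → ‖ev h y‖ ≤ ρ := by
    by_cases hne : (Uᶜ).Nonempty
    · obtain ⟨z, hz, hmax⟩ := hU.isClosed_compl.isCompact.exists_isMaxOn hne
        (f := fun y => ‖ev h y‖) (ev h).continuous.norm.continuousOn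
      exact ⟨‖ev h z‖, norm_nonneg _, hlt z hz, fun y hy => hmax hy⟩
    · refine ⟨0, le_rfl, one_pos, fun y hy => (hne ⟨y, hy⟩).elim⟩
  obtain ⟨N, hN⟩ := exists_pow_lt_of_lt_one hε ρ1
  refine ⟨h ^ N, ?_, by simp [hx], ?_⟩
  · refine norm_le_of ev hev zero_le_one fun y => ?_
    simp only [map_pow, ContinuousMap.pow_apply, norm_pow]
    exact pow_le_one₀ (norm_nonneg _) (ev_le_one ev hev hle y)
  · intro y hy
    simp only [map_pow, ContinuousMap.pow_apply, norm_pow]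
    exact (pow_le_pow_left₀ (norm_nonneg _) (hρ y hy) N).trans hN.le

theorem bishop (hev : ∀ f, ‖ev f‖ = ‖f‖) (x : X) {w : X → ℝ} (hw : Continuous w) (hpos : ∀ y, 0 < w y)
    (hK : ∀ y ∈ K ev x, 1 ≤ w y) :
    ∃ h : A, ‖h‖ ≤ 1 ∧ ev h x = 1 ∧ ∀ y, ‖ev h y‖ ≤ w y := by
  obtain ⟨z, -, hz⟩ := isCompact_univ.exists_isMinOn ⟨x, Set.mem_univ x⟩ hw.continuousOn
  set m := min (w z) (1/2) with hm
  have m0 : 0 < m := lt_min (hpos z) (by norm_num)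
  have m1 : m ≤ 1/2 := min_le_right _ _
  have mw : ∀ y, m ≤ w y := fun y => (min_le_left _ _).trans (hz (Set.mem_univ y))
  have hex : ∀ n : ℕ, ∃ h : A, ‖h‖ ≤ 1 ∧ ev h x = 1 ∧
      ∀ y, ¬ (1 - (1/2:ℝ)^(n+1) * (1 - m) < w y) → ‖ev h y‖ ≤ m := by
    intro n
    refine peak ev hev x (U := {y | 1 - (1/2:ℝ)^(n+1) * (1 - m) < w y})
      (isOpen_lt continuous_const hw) ?_ m0
    intro y hy
    have h1 := hK y hy
    have h2 : 0 < (1/2:ℝ)^(n+1) * (1 - m) := by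
      have : 0 < 1 - m := by linarith
      positivity
    show 1 - (1/2:ℝ)^(n+1) * (1 - m) < w y
    linarith
  choose h h1 h2 h3 using hex
  have hs1 : HasSum (fun n : ℕ => (1/2:ℝ)^(n+1)) 1 := by
    have := hasSum_geometric_two' 1
    convert this using 2 with n
    rw [pow_succ]; simp; ring
  have hnb : ∀ n, ‖((1/2:ℂ)^(n+1)) • h n‖ ≤ (1/2:ℝ)^(n+1) := by
    intro n
    rw [norm_smul, norm_pow]
    have : ‖(1/2:ℂ)‖ = 1/2 := by norm_num
    rw [this]
    have : (0:ℝ) ≤ (1/2)^(n+1) := by positivity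
    nlinarith [h1 n]
  have hsum : Summable (fun n => ((1/2:ℂ)^(n+1)) • h n) := Summable.of_norm_bounded hs1.summable hnb
  let L : X → A →L[ℂ] ℂ := fun y => LinearMap.mkContinuous
    { toFun := fun f => ev f y, map_add' := by simp, map_smul' := by simp } 1
    (fun f => by simpa using ev_le ev hev f y)
  have Lap : ∀ y f, L y f = ev f y := fun y f => rfl
  have hev' : ∀ y, ev (∑' n, ((1/2:ℂ)^(n+1)) • h n) y = ∑' n, ((1/2:ℂ)^(n+1)) * ev (h n) y := by
    intro y
    rw [← Lap, (L y).map_tsum hsum]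
    simp [Lap]
  refine ⟨∑' n, ((1/2:ℂ)^(n+1)) • h n, tsum_of_norm_bounded hs1 hnb, ?_, ?_⟩
  · rw [hev']
    simp only [h2, mul_one]
    have := (Complex.hasSum_ofReal.2 hs1).tsum_eq
    simpa using this
  · intro y
    rw [hev']
    by_cases hwy : 1 ≤ w y
    · refine (tsum_of_norm_bounded hs1 fun n => ?_).trans hwy
      have := hnb n
      rw [norm_mul, norm_pow]
      have e : ‖(1/2:ℂ)‖ = 1/2 := by norm_num
      rw [e]
      have : (0:ℝ) ≤ (1/2)^(n+1) := by positivity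
      nlinarith [ev_le_one ev hev (h1 n) y]
    push Not at hwy
    have hexN : ∃ n : ℕ, ¬ (1 - (1/2:ℝ)^(n+1) * (1 - m) < w y) := by
      obtain ⟨n, hn⟩ := exists_pow_lt_of_lt_one (show 0 < 1 - w y by linarith) (show (1/2:ℝ) < 1 by norm_num)
      refine ⟨n, ?_⟩
      have h0 : (0:ℝ) < (1/2)^n := by positivity
      rw [pow_succ]
      nlinarith
    classical
    set N := Nat.find hexN with hN
    have hN1 : ∀ n, N ≤ n → ¬ (1 - (1/2:ℝ)^(n+1) * (1 - m) < w y) := by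
      intro n hn
      have := Nat.find_spec hexN
      rw [← hN] at this
      have hp : (1/2:ℝ)^(n+1) ≤ (1/2)^(N+1) :=
        pow_le_pow_of_le_one (by norm_num) (by norm_num) (by omega)
      nlinarith
    have hwN : 1 - (1/2:ℝ)^N * (1 - m) ≤ w y := by
      rcases Nat.eq_zero_or_pos N with h0 | h0
      · rw [h0]; simpa using mw y
      · have := Nat.find_min hexN (m := N - 1) (by omega)
        rw [show N - 1 + 1 = N by omega] at this
        push Not at this
        exact this.le
    have hs2 : HasSum (fun n : ℕ => if N ≤ n then (1/2:ℝ)^(n+1) else 0) ((1/2:ℝ)^N) := by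
      have := (hasSum_nat_add_iff (f := fun n : ℕ => if N ≤ n then (1/2:ℝ)^(n+1) else 0)
        (g := (1/2:ℝ)^N) N).1 (by
          have := hs1.mul_left ((1/2:ℝ)^N)
          rw [mul_one] at this
          have e : (fun n : ℕ => if N ≤ n + N then (1/2:ℝ)^(n+N+1) else 0) =
              fun n => (1/2:ℝ)^N * (1/2)^(n+1) := by
            funext n; rw [if_pos (by omega)]; ring
          rw [e]; exact this)
      rwa [Finset.sum_eq_zero, add_zero] at this
      intro i hi
      have := Finset.mem_range.1 hi
      rw [if_neg (by omega)]
    have hs3 := hs1.sub (hs2.mul_right (1 - m))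
    refine (tsum_of_norm_bounded hs3 fun n => ?_).trans hwN
    rw [norm_mul, norm_pow]
    have e : ‖(1/2:ℂ)‖ = 1/2 := by norm_num
    rw [e]
    have hp : (0:ℝ) ≤ (1/2)^(n+1) := by positivity
    split_ifs with hn
    · nlinarith [h3 n y (hN1 n hn)]
    · nlinarith [ev_le_one ev hev (h1 n) y]


def Fs (p : X) (l : ℂ) : Set A := {f : A | ‖f‖ = 1 ∧ ev f p = l}

theorem norm_add_eq_two (hev : ∀ f, ‖ev f‖ = ‖f‖) {f g : A} (hf : ‖f‖ = 1) (hg : ‖g‖ = 1)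
    {p : X} {l : ℂ} (hl : ‖l‖ = 1) (h1 : ev f p = l) (h2 : ev g p = l) : ‖f + g‖ = 2 := by
  apply le_antisymm (norm_add_le_two hf hg)
  refine le_trans ?_ (ev_le ev hev (f + g) p)
  rw [map_add, ContinuousMap.add_apply, h1, h2, ← two_mul, norm_mul, hl]; norm_num

theorem eq_of_norm_half {z w : ℂ} (hz : ‖z‖ ≤ 1) (hw : ‖w‖ ≤ 1)
    (h : ‖(1/2:ℂ) * (z + w)‖ = 1) : z = w ∧ ‖z‖ = 1 := by
  have h1 : ‖z + w‖ = 2 := by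
    rw [norm_mul] at h; norm_num at h; linarith
  have h2 := norm_add_le z w
  have h3 : ‖z‖ = 1 := by linarith
  have h4 : ‖w‖ = 1 := by linarith
  refine ⟨eq_of_norm_eq_of_norm_add_eq (by rw [h3, h4]) (by rw [h1, h3, h4]; norm_num), h3⟩

theorem exists_Fs (hev : ∀ f, ‖ev f‖ = ‖f‖) {C : Set A} (hC : MC C) {c₀ : A} (hc₀ : c₀ ∈ C) :
    ∃ p l, ‖l‖ = 1 ∧ C = Fs ev p l := by
  have mid : ∀ f ∈ C, ∀ g ∈ C, (1/2:ℂ) • (f + g) ∈ C := by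
    intro f hf g hg
    have := hC.conv hf hg (a := 1/2) (b := 1/2) (by norm_num) (by norm_num) (by norm_num)
    have e : (1/2:ℂ) • (f + g) = (1/2:ℝ) • f + (1/2:ℝ) • g := by
      rw [smul_add, ← Complex.coe_smul, ← Complex.coe_smul]; norm_num
    rwa [e]
  have mid' : ∀ f ∈ C, ∀ g ∈ C, ∀ y, ‖ev ((1/2:ℂ) • (f + g)) y‖ = 1 → 
      ev f y = ev g y ∧ ‖ev f y‖ = 1 := by
    intro f hf g hg y hy
    refine eq_of_norm_half (ev_le_one ev hev (hC.n f hf).le y) (ev_le_one ev hev (hC.n g hg).le y) ?_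
    simpa [mul_add] using hy
  have : Nonempty C := ⟨⟨c₀, hc₀⟩⟩
  obtain ⟨p, hp⟩ := IsCompact.nonempty_iInter_of_directed_nonempty_isCompact_isClosed
    (fun f : C => {y : X | ‖ev f.1 y‖ = 1})
    (by
      rintro ⟨f, hf⟩ ⟨g, hg⟩
      refine ⟨⟨_, mid f hf g hg⟩, fun y hy => (mid' f hf g hg y hy).2, fun y hy => ?_⟩
      have := mid' f hf g hg y hy
      show ‖ev g y‖ = 1
      rw [← this.1]; exact this.2)
    (fun f => exists_attain ev hev (hC.n f.1 f.2))
    (fun f => (isClosed_eq (ev f.1).continuous.norm continuous_const).isCompact)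
    (fun f => isClosed_eq (ev f.1).continuous.norm continuous_const)
  have hp' : ∀ f ∈ C, ‖ev f p‖ = 1 := fun f hf => Set.mem_iInter.1 hp ⟨f, hf⟩
  have hsub : ∀ f ∈ C, ev f p = ev c₀ p := fun f hf => 
    (mid' f hf c₀ hc₀ p (hp' _ (mid f hf c₀ hc₀))).1
  refine ⟨p, ev c₀ p, hp' _ hc₀, Set.Subset.antisymm (fun f hf => ⟨hC.n f hf, hsub f hf⟩) ?_⟩
  rintro f ⟨hf, hfp⟩
  exact hC.max f hf fun c hc => norm_add_eq_two ev hev hf (hC.n c hc) (hp' _ hc₀) hfp (hsub c hc)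

theorem Fs_MC {p : X} {l m : ℂ} (hl : ‖l‖ = 1) (hm : ‖m‖ = 1) (h : MC (Fs ev p l)) :
    MC (Fs ev p m) := by
  have l0 : l ≠ 0 := by intro h; simp [h] at hl
  have m0 : m ≠ 0 := by intro h; simp [h] at hm
  have := h.smul (α := l / m) (by simp [hl, hm])
  convert this using 1
  ext f
  simp only [Fs, Set.mem_ofPred_eq, norm_smul, norm_div, hl, hm, map_smul, ContinuousMap.smul_apply,
    smul_eq_mul]
  norm_num
  intro _
  constructor
  · intro h; rw [h]; field_simp
  · intro h; field_simp at h; exact h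

theorem K_swap (hev : ∀ f, ‖ev f‖ = ‖f‖) {p z : X} (hp : MC (Fs ev p 1)) (hz : z ∈ K ev p) :
    p ∈ K ev z := by
  intro f hf hfz
  have nf : ‖f‖ = 1 := norm_one_of ev hev (ev_le_one ev hev hf) (x := z) (by simp [hfz])
  have : f ∈ Fs ev p 1 := hp.max f nf fun c hc =>
    norm_add_eq_two ev hev nf hc.1 (by simp) hfz (hz c hc.1.le hc.2)
  exact this.2

theorem damp (hev : ∀ f, ‖ev f‖ = ‖f‖) {x : X} {g : A} (hg : ∀ y ∈ K ev x, ‖ev g y‖ ≤ 1) :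
    ∃ f : A, ‖f‖ ≤ 1 ∧ ev f x = ev g x ∧ ∀ y, ev g y = 0 → ev f y = 0 := by
  obtain ⟨h, h1, h2, h3⟩ := bishop ev hev x (w := fun y => (max 1 ‖ev g y‖)⁻¹)
    ((continuous_const.max (ev g).continuous.norm).inv₀ fun y => by positivity)
    (fun y => by positivity) (fun y hy => by simp [hg y hy])
  refine ⟨h * g, norm_le_of ev hev zero_le_one fun y => ?_, by simp [h2], fun y hy => by simp [hy]⟩
  rw [map_mul, ContinuousMap.mul_apply, norm_mul]
  have h4 := h3 y
  have h5 : ‖ev g y‖ ≤ max 1 ‖ev g y‖ := le_max_right _ _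
  have h6 : 0 < max 1 ‖ev g y‖ := by positivity
  calc _ ≤ (max 1 ‖ev g y‖)⁻¹ * max 1 ‖ev g y‖ := by gcongr
    _ = 1 := by field_simp

theorem const_K (hev : ∀ f, ‖ev f‖ = ‖f‖) {p y : X} (hp : MC (Fs ev p 1)) (hy : y ∈ K ev p) 
    (g : A) : ev g y = ev g p := by
  by_contra hne
  set g1 : A := g - algebraMap ℂ A (ev g y) with hg1
  have e1 : ∀ x, ev g1 x = ev g x - ev g y := by intro x; simp [hg1]
  obtain ⟨z, hz, hmax⟩ := (isClosed_K ev p).isCompact.exists_isMaxOn ⟨p, self_mem_K p⟩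
    (f := fun y => ‖ev g1 y‖) (ev g1).continuous.norm.continuousOn
  have hz0 : 0 < ‖ev g1 z‖ := by
    refine lt_of_lt_of_le ?_ (hmax (self_mem_K p))
    rw [norm_pos_iff, e1, sub_ne_zero]
    exact fun h => hne h.symm
  have hz0' : ev g1 z ≠ 0 := norm_pos_iff.1 hz0
  have hpz := K_swap ev hev hp hz
  obtain ⟨f, f1, f2, f3⟩ := damp ev hev (x := z) (g := (ev g1 z)⁻¹ • g1) (by
    intro y' hy'
    have : y' ∈ K ev p := fun f hf hfp => hy' f hf (hz f hf hfp)
    have := hmax this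
    simp only [map_smul, ContinuousMap.smul_apply, smul_eq_mul, norm_mul, norm_inv]
    rw [inv_mul_le_iff₀ hz0, mul_one]; exact this)
  have f4 : ev f z = 1 := by rw [f2]; simp [hz0']
  have f5 : ev f y = 1 := hy f f1 (hpz f f1 f4)
  have f6 : ev f y = 0 := f3 y (by simp [e1])
  rw [f6] at f5; exact zero_ne_one f5

theorem sep_K (hev : ∀ f, ‖ev f‖ = ‖f‖) {p y : X} (hp : MC (Fs ev p 1)) (hy : y ∉ K ev p) :
    ∃ k ∈ Fs ev p 1, ev k y = 0 := by
  obtain ⟨h, h1, h2, h3⟩ : ∃ h : A, ‖h‖ ≤ 1 ∧ ev h p = 1 ∧ ev h y ≠ 1 := by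
    simpa [K] using hy
  have h4 : 1 - ev h y ≠ 0 := sub_ne_zero.2 (Ne.symm h3)
  set g : A := (1 - ev h y)⁻¹ • (h - algebraMap ℂ A (ev h y)) with hg
  have gp : ev g p = 1 := by simp [hg, h2, h4]
  obtain ⟨f, f1, f2, f3⟩ := damp ev hev (x := p) (g := g) (by
    intro y' hy'
    rw [const_K ev hev hp hy' g, gp]; simp)
  rw [gp] at f2
  exact ⟨f, ⟨norm_one_of ev hev (ev_le_one ev hev f1) (x := p) (by simp [f2]), f2⟩, f3 y (by simp [hg])⟩

theorem good_peak (hev : ∀ f, ‖ev f‖ = ‖f‖) (p : X) {U : Set X} (hU : IsOpen U)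
    (hKU : K ev p ⊆ U) {ε : ℝ} (hε : 0 < ε) :
    ∃ k : A, ev k p = 1 ∧ (∀ y, ‖ev k y‖ ≤ 1) ∧ (∀ y, ‖1 - ev k y‖ ≤ 1) ∧
      ∀ y, y ∉ U → ‖ev k y‖ ≤ ε := by
  obtain ⟨h, h1, h2, h3⟩ := peak ev hev p hU hKU (ε := 1/2) (by norm_num)
  set e : ℝ := ε / 2 with he
  have e0 : 0 < e := by positivity
  have e1 : (1 + (e:ℂ)) ≠ 0 := by
    have : (1 + e : ℝ) ≠ 0 := by positivity
    exact_mod_cast this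
  set t : A := (1 + (e:ℂ))⁻¹ • h with ht
  have nt : ‖t‖ < 1 := by
    have : ‖(1 + (e:ℂ))‖ = 1 + e := by
      rw [show (1 + (e:ℂ)) = ((1 + e : ℝ) : ℂ) by push_cast; rfl, Complex.norm_real]
      exact Real.norm_of_nonneg (by positivity)
    rw [ht, norm_smul, norm_inv, this, inv_mul_lt_iff₀ (by positivity)]; linarith
  set u := Units.oneSub t nt with hu
  have hu' : (u : A) = 1 - t := rfl
  set k : A := ((e:ℂ) / (1 + (e:ℂ))) • ((u⁻¹ : Aˣ) : A) with hk
  have key : ∀ y, ev k y * (1 + e - ev h y) = e := by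
    intro y
    have h4 : ev ((u⁻¹ : Aˣ) : A) y * ev (u : A) y = 1 := by
      rw [← ContinuousMap.mul_apply, ← map_mul, Units.inv_mul]; simp
    rw [hu'] at h4
    simp only [ht, map_sub, map_one, map_smul, ContinuousMap.sub_apply, ContinuousMap.one_apply,
      ContinuousMap.smul_apply, smul_eq_mul] at h4
    simp only [hk, map_smul, ContinuousMap.smul_apply, smul_eq_mul]
    field_simp at h4 ⊢
    linear_combination (e:ℂ) * h4
  have lower : ∀ y, 1 + e - ‖ev h y‖ ≤ ‖1 + (e:ℂ) - ev h y‖ := by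
    intro y
    have := norm_sub_norm_le (1 + (e:ℂ)) (ev h y)
    rw [show ‖(1 + (e:ℂ))‖ = 1 + e by
      rw [show (1 + (e:ℂ)) = ((1 + e : ℝ) : ℂ) by push_cast; rfl, Complex.norm_real]
      exact Real.norm_of_nonneg (by positivity)] at this
    exact this
  have nkey : ∀ y, ‖ev k y‖ * ‖1 + (e:ℂ) - ev h y‖ = e := by
    intro y
    rw [← norm_mul, key, Complex.norm_real, Real.norm_of_nonneg e0.le]
  have hh := fun y => ev_le_one ev hev h1 y
  have pos : ∀ y, 0 < ‖1 + (e:ℂ) - ev h y‖ := fun y => by linarith [lower y, hh y]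
  refine ⟨k, ?_, ?_, ?_, ?_⟩
  · have := key p
    rw [h2] at this
    have e2 : (e:ℂ) ≠ 0 := by exact_mod_cast e0.ne'
    have : (ev k p - 1) * e = 0 := by linear_combination this
    rcases mul_eq_zero.1 this with h | h
    · exact sub_eq_zero.1 h
    · exact (e2 h).elim
  · intro y
    have a := lower y
    have b := nkey y
    have c := hh y
    nlinarith [norm_nonneg (ev k y)]
  · intro y
    have a : ‖1 - ev k y‖ * ‖1 + (e:ℂ) - ev h y‖ = ‖1 - ev h y‖ := by
      rw [← norm_mul]; congr 1; linear_combination - key y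
    have b : ‖1 - ev h y‖ ≤ ‖1 + (e:ℂ) - ev h y‖ := by
      have re := (Complex.re_le_norm (ev h y)).trans (hh y)
      apply le_of_sq_le_sq _ (norm_nonneg _)
      rw [Complex.sq_norm, Complex.sq_norm, Complex.normSq_apply, Complex.normSq_apply]
      simp; nlinarith
    have c := pos y
    by_contra hcon
    push Not at hcon
    nlinarith
  · intro y hy
    have a := lower y
    have b := nkey y
    have c := h3 y hy
    nlinarith [norm_nonneg (ev k y)]

theorem near (hev : ∀ f, ‖ev f‖ = ‖f‖) {p : X} (hp : MC (Fs ev p 1)) {a : A} (ha : ‖a‖ ≤ 1)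
    {l : ℂ} (hl : ‖l‖ = 1) {r : ℝ} (hr : 0 ≤ r) (hap : ev a p = r * l) {η : ℝ} (hη : 0 < η)
    (hη1 : η ≤ 1) : ∃ f ∈ Fs ev p l, ‖f - a‖ ≤ 1 - r + 2 * η := by
  have nap : ‖ev a p‖ = r := by
    rw [hap, norm_mul, hl, Complex.norm_real, Real.norm_of_nonneg hr, mul_one]
  have r1 : r ≤ 1 := nap ▸ ev_le_one ev hev ha p
  set c : ℝ := 1 - (1 - η) * r with hc
  have c0 : 0 < c := by nlinarith
  have hay := fun y => ev_le_one ev hev ha y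
  obtain ⟨h, h1, h2, h3⟩ := bishop ev hev p (w := fun y => (1 - (1 - η) * ‖ev a y‖) / c)
    ((continuous_const.sub (continuous_const.mul (ev a).continuous.norm)).div_const _)
    (fun y => by
      have := hay y
      refine div_pos ?_ c0
      nlinarith [norm_nonneg (ev a y)])
    (fun y hy => by rw [const_K ev hev hp hy a, nap, ← hc, div_self c0.ne'])
  set f : A := ((1 - η : ℝ):ℂ) • a + ((c : ℂ) * l) • h with hf
  have hfy : ∀ y, ev f y = ((1 - η : ℝ):ℂ) * ev a y + ((c : ℂ) * l) * ev h y := by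
    intro y; simp [hf]
  have fp : ev f p = l := by
    rw [hfy, hap, h2, hc]; push_cast; ring
  refine ⟨f, ⟨norm_one_of ev hev ?_ (x := p) (by rw [fp, hl]), fp⟩, ?_⟩
  · intro y
    rw [hfy]
    refine (norm_add_le _ _).trans ?_
    rw [norm_mul, norm_mul, norm_mul, hl, Complex.norm_real, Complex.norm_real,
      Real.norm_of_nonneg (by linarith : 0 ≤ 1 - η), Real.norm_of_nonneg c0.le]
    have := h3 y
    rw [le_div_iff₀ c0] at this
    linarith
  · have e : f - a = ((-η : ℝ):ℂ) • a + ((c : ℂ) * l) • h := by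
      rw [hf]; push_cast; module
    rw [e]
    refine (norm_add_le _ _).trans ?_
    rw [norm_smul, norm_smul, norm_mul, hl, Complex.norm_real, Complex.norm_real, norm_neg,
      Real.norm_of_nonneg hη.le, Real.norm_of_nonneg c0.le]
    nlinarith

theorem far (hev : ∀ f, ‖ev f‖ = ‖f‖) {p : X} (hp : MC (Fs ev p 1)) {a : A} (ha : ‖a‖ ≤ 1)
    {l : ℂ} (hl : ‖l‖ = 1) {r : ℝ} (hr : 0 ≤ r) (hap : ev a p = r * l) {η : ℝ} (hη : 0 < η)
    (hη1 : η ≤ 1) : ∃ f ∈ Fs ev p (-l), ‖f - a‖ ≤ 1 + r + 3 * η := by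
  have nap : ‖ev a p‖ = r := by
    rw [hap, norm_mul, hl, Complex.norm_real, Real.norm_of_nonneg hr, mul_one]
  have hay := fun y => ev_le_one ev hev ha y
  obtain ⟨k, k1, k2, k3, k4⟩ := good_peak ev hev p (U := {y | ‖ev a y‖ < r + η})
    (isOpen_lt (ev a).continuous.norm continuous_const) (fun y hy => by
      show ‖ev a y‖ < r + η
      rw [const_K ev hev hp hy a, nap]; linarith) hη
  have n2 : ‖a * (1 - k)‖ ≤ 1 := norm_le_of ev hev zero_le_one fun y => by
    simp only [map_mul, map_sub, map_one, ContinuousMap.mul_apply, ContinuousMap.sub_apply,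
      ContinuousMap.one_apply, norm_mul]
    exact mul_le_one₀ (hay y) (norm_nonneg _) (k3 y)
  obtain ⟨f, hf, hfa⟩ := near ev hev hp n2 (l := -l) (by rw [norm_neg, hl]) le_rfl
    (by simp [k1]) hη hη1
  refine ⟨f, hf, ?_⟩
  have n3 : ‖a * k‖ ≤ r + η := norm_le_of ev hev (by linarith) fun y => by
    simp only [map_mul, ContinuousMap.mul_apply, norm_mul]
    by_cases hy : ‖ev a y‖ < r + η
    · nlinarith [k2 y, norm_nonneg (ev a y), norm_nonneg (ev k y)]
    · nlinarith [k4 y hy, hay y, norm_nonneg (ev a y), norm_nonneg (ev k y)]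
  have e : f - a = (f - a * (1 - k)) - a * k := by noncomm_ring
  rw [e]
  refine (norm_sub_le _ _).trans ?_
  linarith

theorem val {B : Type*} [NormedAddCommGroup B] [NormedSpace ℂ B] {T : A → B} {T' : B → A}
    (hT : SI T T') (hev : ∀ f, ‖ev f‖ = ‖f‖) {p : X} (hp : MC (Fs ev p 1))
    {l : ℂ} (hl : ‖l‖ = 1) {q : B →L[ℂ] ℂ} (hq : ∀ b, ‖q b‖ ≤ ‖b‖)
    (hq1 : ∀ f ∈ Fs ev p l, q (T f) = 1) {a : A} (ha : ‖a‖ = 1) {r : ℝ} (hr : 0 ≤ r)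
    (hap : ev a p = r * l) : q (T a) = r := by
  have nap : ‖ev a p‖ = r := by
    rw [hap, norm_mul, hl, Complex.norm_real, Real.norm_of_nonneg hr, mul_one]
  have r1 : r ≤ 1 := nap ▸ ev_le_one ev hev ha.le p
  have hd : ∀ f, ‖f‖ = 1 → ‖q (T f) - q (T a)‖ ≤ ‖f - a‖ := by
    intro f hf
    rw [← map_sub, ← hT.d1 f a hf ha]
    exact hq _
  have h1 : ‖1 - q (T a)‖ ≤ 1 - r := by
    apply le_of_forall_pos_le_add
    intro ε hε
    obtain ⟨f, hf, hfa⟩ := near ev hev hp ha.le hl hr hap (η := min (ε / 2) 1) (by positivity)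
      (min_le_right _ _)
    have := hd f hf.1
    rw [hq1 f hf] at this
    linarith [min_le_left (ε / 2) 1]
  have hpl : MC (Fs ev p (-l)) := Fs_MC ev (by simp) (by rw [norm_neg, hl]) hp
  have hneg : ∀ f ∈ Fs ev p (-l), q (T f) = -1 := by
    intro f hf
    have h2 := hT.neg hpl hf
    have n2 : ‖-(T f)‖ = 1 := by rw [norm_neg]; exact hT.n1 f hf.1
    have h3 : T' (-(T f)) ∈ Fs ev p l := ⟨hT.n2 _ n2, by
      have := h2.2
      rw [map_neg, ContinuousMap.neg_apply, neg_inj] at this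
      exact this⟩
    have h4 := hq1 _ h3
    rw [hT.i2 _ n2, map_neg] at h4
    rw [← h4, neg_neg]
  have h2 : ‖-1 - q (T a)‖ ≤ 1 + r := by
    apply le_of_forall_pos_le_add
    intro ε hε
    obtain ⟨f, hf, hfa⟩ := far ev hev hp ha.le hl hr hap (η := min (ε / 3) 1) (by positivity)
      (min_le_right _ _)
    have := hd f hf.1
    rw [hneg f hf] at this
    linarith [min_le_left (ε / 3) 1]
  have a1 := (Complex.re_le_norm _).trans h1
  have a2 := (neg_le_abs _).trans ((Complex.abs_re_le_norm _).trans h2)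
  simp at a1 a2
  have re : (q (T a)).re = r := by linarith
  have a3 : ‖1 - q (T a)‖ ^ 2 ≤ (1 - r) ^ 2 := by
    have := norm_nonneg (1 - q (T a))
    nlinarith
  rw [Complex.sq_norm, Complex.normSq_apply] at a3
  simp [re] at a3
  have im : (q (T a)).im = 0 := by nlinarith
  exact Complex.ext (by simpa using re) (by simpa using im)

theorem circ {m : ℂ → ℂ} (h1 : m 1 = 1) (hn : ∀ a, ‖a‖ = 1 → ‖m a‖ = 1)
    (hd : ∀ a b, ‖a‖ = 1 → ‖b‖ = 1 → ‖m a - m b‖ = ‖a - b‖) :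
    (∀ a, ‖a‖ = 1 → m a = a) ∨ (∀ a, ‖a‖ = 1 → m a = starRingEnd ℂ a) := by
  have sq : ∀ z : ℂ, ‖z‖ = 1 → z.re * z.re + z.im * z.im = 1 := by
    intro z hz
    rw [← Complex.normSq_apply, Complex.normSq_eq_norm_sq, hz]; norm_num
  have ip : ∀ a b, ‖a‖ = 1 → ‖b‖ = 1 →
      (m a).re * (m b).re + (m a).im * (m b).im = a.re * b.re + a.im * b.im := by
    intro a b ha hb
    have h := congrArg (· ^ 2) (hd a b ha hb)
    simp only [Complex.sq_norm, Complex.normSq_apply, Complex.sub_re, Complex.sub_im] at h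
    have := sq _ ha
    have := sq _ hb
    have := sq _ (hn a ha)
    have := sq _ (hn b hb)
    nlinarith
  have re : ∀ a, ‖a‖ = 1 → (m a).re = a.re := by
    intro a ha
    have := ip a 1 ha (by simp)
    rw [h1] at this
    simpa using this
  have nI : ‖Complex.I‖ = 1 := by simp
  have rI : (m Complex.I).re = 0 := by simpa using re _ nI
  have sI := sq _ (hn _ nI)
  rw [rI] at sI
  have im : ∀ a, ‖a‖ = 1 → (m a).im * (m Complex.I).im = a.im := by
    intro a ha
    have := ip a Complex.I ha nI
    rw [rI] at this
    simpa using this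
  have : ((m Complex.I).im - 1) * ((m Complex.I).im + 1) = 0 := by linarith
  rcases mul_eq_zero.1 this with h | h
  · left
    intro a ha
    refine Complex.ext (re a ha) ?_
    rw [← im a ha, sub_eq_zero.1 h, mul_one]
  · right
    intro a ha
    refine Complex.ext (by simpa using re a ha) ?_
    have := im a ha
    rw [eq_neg_of_add_eq_zero_left h] at this
    simp; linarith

theorem key {B : Type*} [NormedAddCommGroup B] [NormedSpace ℂ B] {T : A → B} {T' : B → A}
    (hT : SI T T') (hev : ∀ f, ‖ev f‖ = ‖f‖) {p : X} (hp : MC (Fs ev p 1)) :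
    ∃ (q : B →L[ℂ] ℂ) (φ : ℂ →ₗ[ℝ] ℂ), (∀ z, φ z = 0 → z = 0) ∧
      ∀ a, ‖a‖ = 1 → q (T a) = φ (ev a p) := by
  have hD : MC (T '' Fs ev p 1) := hT.image hp
  obtain ⟨q, hq, hq1⟩ := exists_functional hD
  have n1 := norm_one_A ev hev p
  have h1F : (1:A) ∈ Fs ev p 1 := ⟨n1, by simp⟩
  have hT1 : T 1 ∈ T '' Fs ev p 1 := ⟨1, h1F, rfl⟩
  have nT1 : ‖T 1‖ = 1 := hT.n1 1 n1
  have step : ∀ α : ℂ, ∃ m : ℂ, ‖α‖ = 1 → ‖m‖ = 1 ∧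
      T '' Fs ev p m = {b | α⁻¹ • b ∈ T '' Fs ev p 1} := by
    intro α
    by_cases hα : ‖α‖ = 1
    swap
    · exact ⟨0, fun h => (hα h).elim⟩
    have α0 : α ≠ 0 := by intro h; simp [h] at hα
    have hDα : MC {b | α⁻¹ • b ∈ T '' Fs ev p 1} := hD.smul (by simp [hα])
    have hC := hT.symm.image hDα
    obtain ⟨p', m, hm, hCeq⟩ := exists_Fs ev hev hC (c₀ := T' (α • T 1))
      ⟨_, by simpa [smul_smul, α0] using hT1, rfl⟩
    have hp' : MC (Fs ev p' 1) := Fs_MC ev hm (by simp) (hCeq ▸ hC)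
    have himg : T '' Fs ev p' m = {b | α⁻¹ • b ∈ T '' Fs ev p 1} := by
      rw [← hCeq, Set.image_image]
      ext b
      constructor
      · rintro ⟨b', hb', rfl⟩
        have e := hT.i2 _ (hDα.n _ hb')
        simp only [e]
        exact hb'
      · intro hb
        exact ⟨b, hb, hT.i2 _ (hDα.n _ hb)⟩
    have hpp : p' ∈ K ev p := by
      by_contra hcon
      obtain ⟨k, hk, hk0⟩ := sep_K ev hev hp hcon
      have := val ev hT hev hp' hm (q := α⁻¹ • q) (by
          intro b; simpa [hα] using hq b) (by
          intro f hf
          have : T f ∈ {b | α⁻¹ • b ∈ T '' Fs ev p 1} := himg ▸ ⟨f, hf, rfl⟩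
          have := hq1 _ this
          rw [map_smul] at this
          exact this) hk.1 (r := 0) le_rfl (by simp [hk0])
      have h2 := hq1 _ ⟨k, hk, rfl⟩
      simp [h2, α0] at this
    refine ⟨m, fun _ => ⟨hm, ?_⟩⟩
    rw [← himg]
    congr 1
    ext f
    simp only [Fs, Set.mem_ofPred_eq, const_K ev hev hp hpp f]
  choose m hm using step
  have hv : ∀ α, ‖α‖ = 1 → ∀ a, ‖a‖ = 1 → ∀ r : ℝ, 0 ≤ r → ev a p = r * m α → q (T a) = r * α := by
    intro α hα a ha r hr hap
    have α0 : α ≠ 0 := by intro h; simp [h] at hα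
    obtain ⟨hmα, himg⟩ := hm α hα
    have := val ev hT hev hp hmα (q := α⁻¹ • q) (by
          intro b; simpa [hα] using hq b) (by
          intro f hf
          have : T f ∈ {b | α⁻¹ • b ∈ T '' Fs ev p 1} := himg ▸ ⟨f, hf, rfl⟩
          have := hq1 _ this
          rw [map_smul] at this
          exact this) ha hr hap
    simp only [smul_apply, smul_eq_mul] at this
    field_simp at this
    rw [this]; ring
  have hpre : ∀ α, ‖α‖ = 1 → ∃ f ∈ Fs ev p (m α), T f = α • T 1 := by
    intro α hα
    have α0 : α ≠ 0 := by intro h; simp [h] at hα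
    have : α • T 1 ∈ T '' Fs ev p (m α) := by
      rw [(hm α hα).2]
      simpa [smul_smul, α0] using hT1
    exact this
  have hcirc := circ (m := m) (by
      obtain ⟨f, hf, hf1⟩ := hpre 1 (by simp)
      rw [one_smul] at hf1
      have := hT.i1 f hf.1
      rw [hf1, hT.i1 1 n1] at this
      rw [← hf.2, ← this]; simp)
    (fun α hα => (hm α hα).1)
    (by
      intro α β hα hβ
      apply le_antisymm
      · obtain ⟨f, hf, hfT⟩ := hpre α hα
        obtain ⟨g, hg, hgT⟩ := hpre β hβ
        have h3 := ev_le ev hev (f - g) p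
        rw [map_sub, ContinuousMap.sub_apply, hf.2, hg.2, ← hT.d1 f g hf.1 hg.1, hfT, hgT, ← sub_smul,
          norm_smul, nT1, mul_one] at h3
        exact h3
      · have nn : ∀ α, ‖α‖ = 1 → ‖m α • (1:A)‖ = 1 := by
          intro α hα; rw [norm_smul, n1, (hm α hα).1, one_mul]
        have hh : ∀ α, ‖α‖ = 1 → q (T (m α • (1:A))) = α := by
          intro α hα
          rw [hv α hα _ (nn α hα) 1 zero_le_one (by simp)]; simp
        have h3 := hq (T (m α • (1:A)) - T (m β • (1:A)))
        rw [map_sub, hh α hα, hh β hβ, hT.d1 _ _ (nn α hα) (nn β hβ), ← sub_smul, norm_smul, n1,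
          mul_one] at h3
        exact h3)
  have polar : ∀ z : ℂ, ∃ (r : ℝ) (l : ℂ), 0 ≤ r ∧ ‖l‖ = 1 ∧ z = r * l := by
    intro z
    by_cases hz : z = 0
    · exact ⟨0, 1, le_rfl, by simp, by simp [hz]⟩
    · have : (‖z‖ : ℂ) ≠ 0 := by exact_mod_cast norm_ne_zero_iff.2 hz
      exact ⟨‖z‖, z / ‖z‖, norm_nonneg _, by simp [hz], by field_simp⟩
  rcases hcirc with hc | hc
  · refine ⟨q, LinearMap.id, fun z hz => hz, fun a ha => ?_⟩
    obtain ⟨r, l, hr, hl, hz⟩ := polar (ev a p)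
    rw [hv l hl a ha r hr (by rw [hc l hl, hz]), hz]; rfl
  · refine ⟨q, Complex.conjAe.toLinearMap, fun z hz => by simpa using hz, fun a ha => ?_⟩
    obtain ⟨r, l, hr, hl, hz⟩ := polar (ev a p)
    have hl' : ‖starRingEnd ℂ l‖ = 1 := by simpa using hl
    rw [hv _ hl' a ha r hr (by rw [hc _ hl', hz]; simp), hz]
    simp

theorem main {B : Type*} [NormedAddCommGroup B] [NormedSpace ℂ B] {T : A → B} {T' : B → A}
    (hT : SI T T') (hev : ∀ f, ‖ev f‖ = ‖f‖) :
    ∃ V : A → B, (∀ f g, V (f + g) = V f + V g) ∧ (∀ (r : ℝ) f, V ((r:ℂ) • f) = (r:ℂ) • V f) ∧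
      (∀ f, ‖V f‖ = ‖f‖) ∧ (∀ b, ∃ f, V f = b) ∧ ∀ f, ‖f‖ = 1 → V f = T f := by
  have hk := fun p : {p : X // MC (Fs ev p 1)} => key ev hT hev p.2
  choose q φ hφ hqφ using hk
  -- normalisation
  have norml : ∀ {E : Type _} [NormedAddCommGroup E] [NormedSpace ℂ E] (f : E), f ≠ 0 →
      ‖((‖f‖⁻¹ : ℝ) : ℂ) • f‖ = 1 := by
    intro E _ _ f hf
    rw [norm_smul, Complex.norm_real, norm_inv, norm_norm, inv_mul_cancel₀ (norm_ne_zero_iff.2 hf)]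
  have hinj : ∀ b : B, (∀ p, q p b = 0) → b = 0 := by
    intro b hb
    by_contra hne
    set b' : B := ((‖b‖⁻¹ : ℝ) : ℂ) • b with hb'
    have nb' : ‖b'‖ = 1 := by
      rw [hb', norm_smul, Complex.norm_real, norm_inv, norm_norm, inv_mul_cancel₀ (norm_ne_zero_iff.2 hne)]
    have nf := hT.n2 b' nb'
    obtain ⟨C, hC, hfC⟩ := exists_MC nf
    obtain ⟨p, l, hl, rfl⟩ := exists_Fs ev hev hC hfC
    have hp := Fs_MC ev hl (m := 1) (by simp) hC
    have h1 := hqφ ⟨p, hp⟩ _ nf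
    rw [hT.i2 _ nb', hb', map_smul, hb ⟨p, hp⟩, smul_zero] at h1
    have h2 := hφ _ _ h1.symm
    have : ev (T' b') p = l := hfC.2
    rw [← hb'] at h2
    simp only [this] at h2
    rw [h2] at hl
    simp at hl
  set V : A → B := fun f => (‖f‖ : ℂ) • T (((‖f‖⁻¹ : ℝ) : ℂ) • f) with hV
  have hφs : ∀ p (r : ℝ) z, φ p ((r:ℂ) • z) = (r:ℂ) • φ p z := by
    intro p r z
    rw [Complex.coe_smul, Complex.coe_smul, (φ p).map_smul]
  have hqV : ∀ p f, q p (V f) = φ p (ev f p) := by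
    intro p f
    by_cases hf : f = 0
    · simp [hV, hf]
    · simp only [hV, map_smul]
      rw [hqφ p _ (norml f hf), map_smul, ContinuousMap.smul_apply, hφs]
      have : ‖f‖ ≠ 0 := norm_ne_zero_iff.2 hf
      rw [smul_smul]
      push_cast
      rw [mul_inv_cancel₀ (by exact_mod_cast this), one_smul]
  have hVT : ∀ f, ‖f‖ = 1 → V f = T f := by
    intro f hf; simp [hV, hf]
  have hVr : ∀ (r : ℝ) f, V ((r:ℂ) • f) = (r:ℂ) • V f := by
    intro r f
    rw [← sub_eq_zero]
    apply hinj
    intro p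
    rw [map_sub, hqV, (q p).map_smul, hqV, map_smul, ContinuousMap.smul_apply, hφs, sub_self]
  refine ⟨V, ?_, hVr, ?_, ?_, hVT⟩
  · intro f g
    rw [← sub_eq_zero]
    apply hinj
    intro p
    rw [map_sub, map_add, hqV, hqV, hqV, map_add, ContinuousMap.add_apply, map_add, sub_self]
  · intro f
    by_cases hf : f = 0
    · simp [hV, hf]
    · simp only [hV, norm_smul]
      rw [hT.n1 _ (norml f hf)]; simp
  · intro b
    by_cases hb : b = 0
    · exact ⟨0, by simp [hV, hb]⟩
    · have nb : ‖((‖b‖⁻¹ : ℝ) : ℂ) • b‖ = 1 := by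
        rw [norm_smul, Complex.norm_real, norm_inv, norm_norm, inv_mul_cancel₀ (norm_ne_zero_iff.2 hb)]
      refine ⟨((‖b‖ : ℝ) : ℂ) • T' (((‖b‖⁻¹ : ℝ) : ℂ) • b), ?_⟩
      have : (‖b‖ : ℂ) ≠ 0 := by exact_mod_cast norm_ne_zero_iff.2 hb
      rw [hVr, hVT _ (hT.n2 _ nb), hT.i2 _ nb, smul_smul]
      push_cast
      rw [mul_inv_cancel₀ this, one_smul]

end UA

theorem exists_SI {E F : Type*} [NormedAddCommGroup E] [NormedAddCommGroup F] {T : E → F}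
    (hmap : ∀ f : E, ‖f‖ = 1 → ‖T f‖ = 1)
    (hsurj : ∀ b : F, ‖b‖ = 1 → ∃ f : E, ‖f‖ = 1 ∧ T f = b)
    (hiso : ∀ f g : E, ‖f‖ = 1 → ‖g‖ = 1 → ‖T f - T g‖ = ‖f - g‖) :
    ∃ T' : F → E, SI T T' := by
  have : ∀ b : F, ∃ f : E, ‖b‖ = 1 → ‖f‖ = 1 ∧ T f = b := by
    intro b
    by_cases hb : ‖b‖ = 1
    · obtain ⟨f, hf⟩ := hsurj b hb
      exact ⟨f, fun _ => hf⟩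
    · exact ⟨0, fun h => (hb h).elim⟩
  choose T' h using this
  refine ⟨T', hmap, fun b hb => (h b hb).1, ?_, fun b hb => (h b hb).2, hiso, ?_⟩
  · intro x hx
    obtain ⟨h1, h2⟩ := h (T x) (hmap x hx)
    have := hiso _ _ h1 hx
    rw [h2, sub_self, norm_zero] at this
    exact sub_eq_zero.1 (norm_eq_zero.1 this.symm)
  · intro y y' hy hy'
    rw [← hiso _ _ (h y hy).1 (h y' hy').1, (h y hy).2, (h y' hy').2]

end MUP


set_option synthInstance.maxHeartbeats 1000000 in
set_option maxHeartbeats 1000000 in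
/-- Every uniform algebra `A` (a closed, point-separating subalgebra
of `C(X,ℂ)` on a compact Hausdorff space `X`, with the sup norm) satisfies the
complex Mazur-Ulam property: every surjective isometry from `S(A)` onto the unit
sphere of a complex Banach space `B₂` extends to a surjective real-linear
isometry from `A` onto `B₂`. -/
theorem stmt11 {X : Type*} [TopologicalSpace X] [CompactSpace X] [T2Space X]
    (A : Subalgebra ℂ C(X, ℂ)) (hclosed : IsClosed (A : Set C(X, ℂ)))
    (hsep : ∀ x y : X, x ≠ y → ∃ f ∈ A, f x ≠ f y)
    (B₂ : Type*) [NormedAddCommGroup B₂] [NormedSpace ℂ B₂] [CompleteSpace B₂]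
    (T : A → B₂)
    (hmap : ∀ f : A, ‖f‖ = 1 → ‖T f‖ = 1)
    (hsurj : ∀ b : B₂, ‖b‖ = 1 → ∃ f : A, ‖f‖ = 1 ∧ T f = b)
    (hiso : ∀ f g : A, ‖f‖ = 1 → ‖g‖ = 1 → ‖T f - T g‖ = ‖f - g‖) :
    ∃ U : A ≃ₗᵢ[ℝ] B₂, ∀ f : A, ‖f‖ = 1 → U f = T f := by
  have : CompleteSpace A := hclosed.completeSpace_coe
  obtain ⟨T', hT⟩ := MUP.exists_SI hmap hsurj hiso
  obtain ⟨V, h1, h2, h3, h4, h5⟩ := MUP.main A.val hT (fun f => rfl)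
  let L : A →ₗᵢ[ℝ] B₂ :=
    { toFun := V
      map_add' := h1
      map_smul' := fun r f => by
        have e : r • f = (r : ℂ) • f := Subtype.ext rfl
        rw [RingHom.id_apply, e, h2 r f, Complex.coe_smul]
      norm_map' := h3 }
  exact ⟨LinearIsometryEquiv.ofSurjective L h4, fun f hf => h5 f hf⟩
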